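/- arXiv:math-ph/0506022 — 3 statements merged into one kernel-verified Lean document; each statement's English description precedes it below -/
import Mathlib

section
/- Hamilton variational principle is equivalent to the Euler–Lagrange equations (coordinate version of Theorem 1, items 1 ⟺ 3): Let L : J → ℝ be smooth and φ : (Fin m → ℝ) → (Fin n → ℝ) be smooth. Then φ is a critical section of the Lagrangian action if and only if φ satisfies the Euler–Lagrange equations at every point. -/
open MeasureTheory

/-- Partial derivative of a real-valued function on `Fin m → ℝ` in the `ν`-th
coordinate direction. -/
noncomputable def pd {m : ℕ} (f : (Fin m → ℝ) → ℝ) (ν : Fin m) (x : Fin m → ℝ) : ℝ :=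
  fderiv ℝ f x (Pi.single ν 1)

/-- First jet prolongation of `φ`. -/
noncomputable def j1 {m n : ℕ} (φ : (Fin m → ℝ) → (Fin n → ℝ)) (x : Fin m → ℝ) :
    (Fin m → ℝ) × (Fin n → ℝ) × (Fin n → Fin m → ℝ) :=
  (x, φ x, fun A ν => pd (fun x' => φ x' A) ν x)

/-- Partial derivative of the Lagrangian in the `y^A` slot. -/
noncomputable def Ly {m n : ℕ} (L : (Fin m → ℝ) × (Fin n → ℝ) × (Fin n → Fin m → ℝ) → ℝ)
    (z : (Fin m → ℝ) × (Fin n → ℝ) × (Fin n → Fin m → ℝ)) (A : Fin n) : ℝ :=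
  fderiv ℝ L z (0, Pi.single A 1, 0)

/-- Partial derivative of the Lagrangian in the `v^A_ν` slot. -/
noncomputable def Lv {m n : ℕ} (L : (Fin m → ℝ) × (Fin n → ℝ) × (Fin n → Fin m → ℝ) → ℝ)
    (z : (Fin m → ℝ) × (Fin n → ℝ) × (Fin n → Fin m → ℝ)) (A : Fin n) (ν : Fin m) : ℝ :=
  fderiv ℝ L z (0, 0, Pi.single A (Pi.single ν 1))


/-- Differentiation under the integral sign for a compactly supported perturbation `w` of `σ`. -/
theorem hasDerivAt_integral_comp_add_smul {X E : Type*} [TopologicalSpace X] [MeasurableSpace X]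
    [OpensMeasurableSpace X] [T2Space X] {μ : Measure X} [IsFiniteMeasureOnCompacts μ]
    [NormedAddCommGroup E] [NormedSpace ℝ E] {L : E → ℝ} (hL : ContDiff ℝ 1 L) {σ w : X → E}
    (hσ : Continuous σ) (hw : Continuous w) (hwc : HasCompactSupport w) :
    HasDerivAt (fun t : ℝ => ∫ x, (L (σ x + t • w x) - L (σ x)) ∂μ)
      (∫ x, fderiv ℝ L (σ x) (w x) ∂μ) 0 := by
  have hLc : Continuous L := hL.continuous
  have hL' : Continuous (fderiv ℝ L) := hL.continuous_fderiv one_ne_zero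
  have hc : Continuous fun p : ℝ × X => fderiv ℝ L (σ p.2 + p.1 • w p.2) (w p.2) := by fun_prop
  obtain ⟨C, hC⟩ := ((isCompact_Icc (a := (-1 : ℝ)) (b := 1)).prod
    hwc.isCompact).exists_bound_of_continuousOn hc.continuousOn
  have hmain := hasDerivAt_integral_of_dominated_loc_of_deriv_le (μ := μ) (x₀ := (0 : ℝ))
    (s := Set.Icc (-1) 1) (F := fun t x => L (σ x + t • w x) - L (σ x))
    (F' := fun t x => fderiv ℝ L (σ x + t • w x) (w x))
    (bound := (tsupport w).indicator fun _ => C)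
    (Icc_mem_nhds (by norm_num) (by norm_num))
    (Filter.Eventually.of_forall fun t => Continuous.aestronglyMeasurable (by fun_prop))
    (by simp) (Continuous.aestronglyMeasurable (by fun_prop))
    (Filter.Eventually.of_forall fun x t ht => ?_)
    ((integrable_indicator_iff (isClosed_tsupport w).measurableSet).2
      (integrableOn_const hwc.isCompact.measure_lt_top.ne))
    (Filter.Eventually.of_forall fun x t _ => ?_)
  · simpa using hmain.2
  · by_cases hx : x ∈ tsupport w
    · simpa [hx] using hC (t, x) ⟨ht, hx⟩
    · simp [hx, image_eq_zero_of_notMem_tsupport hx]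
  · have hline : HasDerivAt (fun t : ℝ => σ x + t • w x) (w x) t := by
      simpa using ((hasDerivAt_id t).smul_const (w x)).const_add (σ x)
    exact (((hL.differentiable one_ne_zero) _).hasFDerivAt.comp_hasDerivAt t hline).sub_const _

section Jet

variable {m n : ℕ} {L : (Fin m → ℝ) × (Fin n → ℝ) × (Fin n → Fin m → ℝ) → ℝ}
  {φ Z : (Fin m → ℝ) → (Fin n → ℝ)}

theorem contDiff_pd {f : (Fin m → ℝ) → ℝ} (hf : ContDiff ℝ (⊤ : ℕ∞) f) (ν : Fin m) :
    ContDiff ℝ (⊤ : ℕ∞) (pd f ν) :=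
  (hf.fderiv_right (m := (⊤ : ℕ∞)) le_rfl).clm_apply contDiff_const

theorem contDiff_j1 (hφ : ContDiff ℝ (⊤ : ℕ∞) φ) : ContDiff ℝ (⊤ : ℕ∞) (j1 φ) :=
  contDiff_id.prodMk (hφ.prodMk (contDiff_pi.2 fun A => contDiff_pi.2 fun ν =>
    contDiff_pd (contDiff_pi.1 hφ A) ν))

theorem contDiff_Ly_j1 (hL : ContDiff ℝ (⊤ : ℕ∞) L) (hφ : ContDiff ℝ (⊤ : ℕ∞) φ) (A : Fin n) :
    ContDiff ℝ (⊤ : ℕ∞) fun x => Ly L (j1 φ x) A :=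
  ((hL.fderiv_right (m := (⊤ : ℕ∞)) le_rfl).comp (contDiff_j1 hφ)).clm_apply contDiff_const

theorem contDiff_Lv_j1 (hL : ContDiff ℝ (⊤ : ℕ∞) L) (hφ : ContDiff ℝ (⊤ : ℕ∞) φ) (A : Fin n)
    (ν : Fin m) : ContDiff ℝ (⊤ : ℕ∞) fun x => Lv L (j1 φ x) A ν :=
  ((hL.fderiv_right (m := (⊤ : ℕ∞)) le_rfl).comp (contDiff_j1 hφ)).clm_apply contDiff_const

theorem contDiff_eulerLagrange (hL : ContDiff ℝ (⊤ : ℕ∞) L) (hφ : ContDiff ℝ (⊤ : ℕ∞) φ)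
    (A : Fin n) : ContDiff ℝ (⊤ : ℕ∞) fun x =>
      Ly L (j1 φ x) A - ∑ ν : Fin m, pd (fun x' => Lv L (j1 φ x') A ν) ν x :=
  (contDiff_Ly_j1 hL hφ A).sub (ContDiff.sum fun ν _ => contDiff_pd (contDiff_Lv_j1 hL hφ A ν) ν)

/-- The vertical part of the first jet prolongation of a variation `Z`. -/
noncomputable def jetVariation (Z : (Fin m → ℝ) → (Fin n → ℝ)) (x : Fin m → ℝ) :
    (Fin m → ℝ) × (Fin n → ℝ) × (Fin n → Fin m → ℝ) :=
  (0, Z x, fun A ν => pd (fun x' => Z x' A) ν x)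

theorem j1_add_smul (hφ : Differentiable ℝ φ) (hZ : Differentiable ℝ Z) (t : ℝ)
    (x : Fin m → ℝ) : j1 (φ + t • Z) x = j1 φ x + t • jetVariation Z x := by
  have hpd (A : Fin n) (ν : Fin m) : pd (fun x' => (φ + t • Z) x' A) ν x =
      pd (fun x' => φ x' A) ν x + t * pd (fun x' => Z x' A) ν x := by
    have h1 := (differentiable_pi.1 hφ A x).hasFDerivAt
    have h2 := (differentiable_pi.1 hZ A x).hasFDerivAt
    have h3 := (h1.add (h2.const_smul t)).fderiv
    exact congrArg (fun l => l (Pi.single ν 1)) h3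
  refine Prod.ext ?_ (Prod.ext ?_ ?_)
  · simp [j1, jetVariation]
  · simp [j1, jetVariation]
  · funext A ν
    exact hpd A ν

theorem continuous_jetVariation (hZ : ContDiff ℝ (⊤ : ℕ∞) Z) : Continuous (jetVariation Z) :=
  continuous_const.prodMk (hZ.continuous.prodMk (continuous_pi fun A => continuous_pi fun ν =>
    (contDiff_pd (contDiff_pi.1 hZ A) ν).continuous))

theorem hasCompactSupport_coord (hZc : HasCompactSupport Z) (A : Fin n) :
    HasCompactSupport fun x => Z x A :=
  hZc.comp_left (g := fun y : Fin n → ℝ => y A) rfl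

theorem hasCompactSupport_jetVariation (hZc : HasCompactSupport Z) :
    HasCompactSupport (jetVariation Z) := by
  refine HasCompactSupport.intro' hZc.isCompact (isClosed_tsupport Z) fun x hx => ?_
  refine Prod.ext rfl (Prod.ext (image_eq_zero_of_notMem_tsupport (f := Z) hx) ?_)
  funext A ν
  have hA : x ∉ tsupport fun x => Z x A := fun h =>
    hx (tsupport_comp_subset (g := fun y : Fin n → ℝ => y A) rfl Z h)
  change fderiv ℝ (fun x' => Z x' A) x (Pi.single ν 1) = 0
  rw [fderiv_of_notMem_tsupport ℝ hA]
  rfl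

theorem fderiv_jetVariation (z : (Fin m → ℝ) × (Fin n → ℝ) × (Fin n → Fin m → ℝ))
    (x : Fin m → ℝ) : fderiv ℝ L z (jetVariation Z x) =
      ∑ A, (Z x A * Ly L z A + ∑ ν, Lv L z A ν * pd (fun x' => Z x' A) ν x) := by
  have hdecomp : jetVariation Z x =
      ∑ A, (Z x A • ((0, Pi.single A 1, 0) :
          (Fin m → ℝ) × (Fin n → ℝ) × (Fin n → Fin m → ℝ)) +
        ∑ ν, pd (fun x' => Z x' A) ν x • (0, 0, Pi.single A (Pi.single ν 1))) := by
    refine Prod.ext ?_ (Prod.ext ?_ ?_)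
    · simp [jetVariation, Prod.fst_sum]
    · funext B
      simp [jetVariation, Prod.fst_sum, Prod.snd_sum, Pi.single_apply]
    · funext B μ
      simp [jetVariation, Prod.snd_sum, Pi.single_apply, Finset.sum_apply, ite_apply]
  rw [hdecomp]
  simp only [map_sum, map_add, map_smul, smul_eq_mul, Ly, Lv, mul_comm]

theorem integral_mul_pd {f g : (Fin m → ℝ) → ℝ} (hf : ContDiff ℝ (⊤ : ℕ∞) f)
    (hg : ContDiff ℝ (⊤ : ℕ∞) g) (hgc : HasCompactSupport g) (ν : Fin m) :
    ∫ x, f x * pd g ν x = -∫ x, g x * pd f ν x := by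
  have hf' := (contDiff_pd hf ν).continuous
  have hg' := (contDiff_pd hg ν).continuous
  have h := integral_mul_fderiv_eq_neg_fderiv_mul_of_integrable (μ := volume) (f := f) (g := g)
    (v := Pi.single ν 1)
    ((hf'.mul hg.continuous).integrable_of_hasCompactSupport hgc.mul_left)
    ((hf.continuous.mul hg').integrable_of_hasCompactSupport (hgc.fderiv_apply ℝ _).mul_left)
    ((hf.continuous.mul hg.continuous).integrable_of_hasCompactSupport hgc.mul_left)
    (fun x _ => hf.differentiable (by simp) x) (fun x _ => hg.differentiable (by simp) x)
  simpa only [pd, mul_comm] using h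

/-- The first variation formula. -/
theorem hasDerivAt_action (hL : ContDiff ℝ (⊤ : ℕ∞) L) (hφ : ContDiff ℝ (⊤ : ℕ∞) φ)
    (hZ : ContDiff ℝ (⊤ : ℕ∞) Z) (hZc : HasCompactSupport Z) :
    HasDerivAt (fun t : ℝ => ∫ x : Fin m → ℝ, (L (j1 (φ + t • Z) x) - L (j1 φ x)))
      (∑ A, ∫ x, Z x A *
        (Ly L (j1 φ x) A - ∑ ν : Fin m, pd (fun x' => Lv L (j1 φ x') A ν) ν x)) 0 := by
  have hder := hasDerivAt_integral_comp_add_smul (μ := volume) (hL.of_le (by simp))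
    (contDiff_j1 hφ).continuous (continuous_jetVariation hZ) (hasCompactSupport_jetVariation hZc)
  simp only [j1_add_smul (hφ.differentiable (by simp)) (hZ.differentiable (by simp))]
  convert hder using 1
  have hZA (A : Fin n) : ContDiff ℝ (⊤ : ℕ∞) fun x => Z x A := contDiff_pi.1 hZ A
  have hint {f : (Fin m → ℝ) → ℝ} (hf : ContDiff ℝ (⊤ : ℕ∞) f) (A : Fin n) :
      Integrable fun x => Z x A * f x :=
    ((hZA A).continuous.mul hf.continuous).integrable_of_hasCompactSupport
      (hasCompactSupport_coord hZc A).mul_right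
  have hint' (A : Fin n) (ν : Fin m) :
      Integrable fun x => Lv L (j1 φ x) A ν * pd (fun x' => Z x' A) ν x :=
    ((contDiff_Lv_j1 hL hφ A ν).continuous.mul
      (contDiff_pd (hZA A) ν).continuous).integrable_of_hasCompactSupport
      ((hasCompactSupport_coord hZc A).fderiv_apply ℝ _).mul_left
  have hsum (A : Fin n) := integrable_finsetSum Finset.univ fun ν _ => hint' A ν
  simp only [fderiv_jetVariation]
  have hadd (A : Fin n) : Integrable fun x => Z x A * Ly L (j1 φ x) A +
      ∑ ν, Lv L (j1 φ x) A ν * pd (fun x' => Z x' A) ν x :=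
    (hint (contDiff_Ly_j1 hL hφ A) A).add (hsum A)
  rw [integral_finsetSum _ fun A _ => hadd A]
  refine Finset.sum_congr rfl fun A _ => ?_
  rw [integral_add (hint (contDiff_Ly_j1 hL hφ A) A) (hsum A),
    integral_finsetSum _ fun ν _ => hint' A ν]
  simp only [mul_sub, Finset.mul_sum]
  have hpd (ν : Fin m) := hint (contDiff_pd (contDiff_Lv_j1 hL hφ A ν) ν) A
  rw [integral_sub (hint (contDiff_Ly_j1 hL hφ A) A) (integrable_finsetSum _ fun ν _ => hpd ν),
    integral_finsetSum _ fun ν _ => hpd ν, sub_eq_add_neg, ← Finset.sum_neg_distrib]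
  congr 1
  exact Finset.sum_congr rfl fun ν _ => (integral_mul_pd (contDiff_Lv_j1 hL hφ A ν) (hZA A)
    (hasCompactSupport_coord hZc A) ν).symm

end Jet

/-- Hamilton variational principle ⟺ Euler–Lagrange equations. -/
theorem critical_section_iff_euler_lagrange
    (m n : ℕ) (hm : 0 < m) (hn : 0 < n)
    (L : (Fin m → ℝ) × (Fin n → ℝ) × (Fin n → Fin m → ℝ) → ℝ) (hL : ContDiff ℝ (⊤ : ℕ∞) L)
    (φ : (Fin m → ℝ) → (Fin n → ℝ)) (hφ : ContDiff ℝ (⊤ : ℕ∞) φ) :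
    (∀ Z : (Fin m → ℝ) → (Fin n → ℝ), ContDiff ℝ (⊤ : ℕ∞) Z → HasCompactSupport Z →
      HasDerivAt
        (fun t : ℝ => ∫ x : Fin m → ℝ, (L (j1 (φ + t • Z) x) - L (j1 φ x))) 0 0) ↔
    (∀ (x : Fin m → ℝ) (A : Fin n),
      Ly L (j1 φ x) A - ∑ ν : Fin m, pd (fun x' => Lv L (j1 φ x') A ν) ν x = 0) := by
  have key : ∀ Z : (Fin m → ℝ) → (Fin n → ℝ), ContDiff ℝ (⊤ : ℕ∞) Z → HasCompactSupport Z →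
      HasDerivAt (fun t : ℝ => ∫ x : Fin m → ℝ, (L (j1 (φ + t • Z) x) - L (j1 φ x)))
        (∑ A, ∫ x, Z x A *
          (Ly L (j1 φ x) A - ∑ ν : Fin m, pd (fun x' => Lv L (j1 φ x') A ν) ν x)) 0 :=
    fun Z hZ hZc => hasDerivAt_action hL hφ hZ hZc
  constructor
  · intro h x A
    have hcont := (contDiff_eulerLagrange hL hφ A).continuous
    have hae := ae_eq_zero_of_integral_contDiff_smul_eq_zero (μ := volume)
      hcont.locallyIntegrable fun g hg hgc => by
        have hZ : ContDiff ℝ (⊤ : ℕ∞) (fun x => (Pi.single A (g x) : Fin n → ℝ)) :=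
          (ContinuousLinearMap.single ℝ (fun _ : Fin n => ℝ) A).contDiff.comp hg
        have hZc : HasCompactSupport (fun x => (Pi.single A (g x) : Fin n → ℝ)) :=
          hgc.comp_left (g := fun r : ℝ => (Pi.single A r : Fin n → ℝ)) (Pi.single_zero A)
        have h0 := (key _ hZ hZc).unique (h _ hZ hZc)
        rw [Finset.sum_eq_single A (fun B _ hB => by simp [Pi.single_eq_of_ne hB])
          (by simp)] at h0
        simpa using h0
    exact congrFun ((hcont.ae_eq_iff_eq volume continuous_const).1 hae) x
  · intro h Z hZ hZc
    simpa [h] using key Z hZ hZc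
end

section
/- First variation formula for the Hamiltonian action (coordinate version): Let h : J → ℝ be smooth, let y : (Fin m → ℝ) → (Fin n → ℝ) and p : (Fin m → ℝ) → (Fin n → Fin m → ℝ) be smooth, and let Z : (Fin m → ℝ) → (Fin n → ℝ) and W : (Fin m → ℝ) → (Fin n → Fin m → ℝ) be smooth and compactly supported. Define Θ_t(x) = Σ_{A,ν} (p^ν_A(x) + t·W^ν_A(x))·∂(y^A + t·Z^A)/∂x^ν(x) − h(x, y(x) + t·Z(x), p(x) + t·W(x)). Then the function t ↦ ∫ ( Θ_t(x) − Θ_0(x) ) dx has derivative at t = 0 equal to ∫ [ Σ_{A,ν} W^ν_A(x)·( ∂y^A/∂x^ν(x) − (∂h/∂p^ν_A)(x, y(x), p(x)) ) − Σ_A Z^A(x)·( Σ_ν ∂p^ν_A/∂x^ν(x) + (∂h/∂y^A)(x, y(x), p(x)) ) ] dx. -/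
open MeasureTheory

/-- Differentiation under the integral sign for a `C¹` family of functions supported in a fixed
compact set. -/
theorem hasDerivAt_integral_of_eq_zero_off_compact {E : Type*} [TopologicalSpace E] [T2Space E]
    [SecondCountableTopology E] [MeasurableSpace E] [BorelSpace E] {μ : Measure E}
    [IsFiniteMeasureOnCompacts μ] {F F' : ℝ → E → ℝ} {K : Set E} (hK : IsCompact K)
    (hF : Continuous (Function.uncurry F)) (hF' : Continuous (Function.uncurry F'))
    (hF_off : ∀ t, ∀ x ∉ K, F t x = 0) (hF'_off : ∀ t, ∀ x ∉ K, F' t x = 0)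
    (hderiv : ∀ t x, HasDerivAt (fun s => F s x) (F' t x) t) (t₀ : ℝ) :
    HasDerivAt (fun t => ∫ x, F t x ∂μ) (∫ x, F' t₀ x ∂μ) t₀ := by
  have hF_slice (t : ℝ) : Continuous (F t) := hF.comp (Continuous.prodMk_right t)
  have hF'_slice (t : ℝ) : Continuous (F' t) := hF'.comp (Continuous.prodMk_right t)
  obtain ⟨C, hC⟩ := ((isCompact_closedBall t₀ 1).prod hK).exists_bound_of_continuousOn
    hF'.continuousOn
  refine (hasDerivAt_integral_of_dominated_loc_of_deriv_le (F := F) (F' := F')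
    (bound := K.indicator fun _ => C) (Metric.closedBall_mem_nhds t₀ one_pos)
    (.of_forall fun t => (hF_slice t).aestronglyMeasurable)
    ((hF_slice t₀).integrable_of_hasCompactSupport (.intro hK (hF_off t₀)))
    (hF'_slice t₀).aestronglyMeasurable ?_ ?_ (.of_forall fun x t _ => hderiv t x)).2
  · refine .of_forall fun x t ht => ?_
    by_cases hx : x ∈ K
    · simpa [hx] using hC (t, x) ⟨ht, hx⟩
    · simp [hx, hF'_off t x hx]
  · exact (integrable_indicator_iff hK.measurableSet).2
      (integrableOn_const hK.measure_lt_top.ne)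

section pd

variable {m : ℕ} {f g : (Fin m → ℝ) → ℝ}

theorem continuous_pd (hf : ContDiff ℝ (⊤ : ℕ∞) f) (ν : Fin m) : Continuous (pd f ν) :=
  (hf.continuous_fderiv (by simp)).clm_apply continuous_const

theorem pd_add_const_mul (hf : Differentiable ℝ f) (hg : Differentiable ℝ g) (t : ℝ) (ν : Fin m)
    (x : Fin m → ℝ) : pd (fun x' => f x' + t * g x') ν x = pd f ν x + t * pd g ν x := by
  unfold pd
  rw [fderiv_fun_add (hf x) ((hg x).const_mul t), fderiv_const_mul (hg x)]
  simp

theorem hasCompactSupport_pd (hf : HasCompactSupport f) (ν : Fin m) :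
    HasCompactSupport (pd f ν) :=
  hf.fderiv_apply ℝ _

theorem pd_eq_zero_of_notMem_tsupport (ν : Fin m) {x : Fin m → ℝ} (hx : x ∉ tsupport f) :
    pd f ν x = 0 := by
  simp [pd, fderiv_of_notMem_tsupport (𝕜 := ℝ) hx]

theorem integral_mul_pd_eq_neg (hf : ContDiff ℝ (⊤ : ℕ∞) f) (hg : ContDiff ℝ (⊤ : ℕ∞) g)
    (hgc : HasCompactSupport g) (ν : Fin m) :
    ∫ x, f x * pd g ν x = -∫ x, pd f ν x * g x :=
  integral_mul_fderiv_eq_neg_fderiv_mul_of_integrable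
    (((continuous_pd hf ν).mul hg.continuous).integrable_of_hasCompactSupport hgc.mul_left)
    ((hf.continuous.mul (continuous_pd hg ν)).integrable_of_hasCompactSupport
      (hasCompactSupport_pd hgc ν).mul_left)
    ((hf.continuous.mul hg.continuous).integrable_of_hasCompactSupport hgc.mul_left)
    (fun x _ => hf.differentiable (by simp) x) (fun x _ => hg.differentiable (by simp) x)

end pd

theorem fderiv_vertical_eq_sum {m n : ℕ}
    (h : (Fin m → ℝ) × (Fin n → ℝ) × (Fin n → Fin m → ℝ) → ℝ)
    (z : (Fin m → ℝ) × (Fin n → ℝ) × (Fin n → Fin m → ℝ))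
    (u : Fin n → ℝ) (w : Fin n → Fin m → ℝ) :
    fderiv ℝ h z (0, u, w) =
      (∑ A, u A * Ly h z A) + ∑ A, ∑ ν, w A ν * Lv h z A ν := by
  have key : ((0, u, w) : (Fin m → ℝ) × (Fin n → ℝ) × (Fin n → Fin m → ℝ)) =
      (∑ A, u A • (0, Pi.single A 1, 0)) +
        ∑ A, ∑ ν, w A ν • (0, 0, Pi.single A (Pi.single ν 1)) := by
    refine Prod.ext ?_ (Prod.ext ?_ ?_)
    · simp [Prod.fst_sum]
    · ext B
      simp [Prod.fst_sum, Prod.snd_sum, Finset.sum_apply, Pi.single_apply]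
    · ext B μ
      simp [Prod.snd_sum, Finset.sum_apply, Pi.single_apply]
  rw [key]
  simp only [map_add, map_sum, map_smul, smul_eq_mul, Ly, Lv]

/-- First variation formula for the Hamiltonian action. -/
theorem first_variation_of_hamiltonian_action
    (m n : ℕ) (hm : 0 < m) (hn : 0 < n)
    (h : (Fin m → ℝ) × (Fin n → ℝ) × (Fin n → Fin m → ℝ) → ℝ) (hh : ContDiff ℝ (⊤ : ℕ∞) h)
    (y : (Fin m → ℝ) → (Fin n → ℝ)) (hy : ContDiff ℝ (⊤ : ℕ∞) y)
    (p : (Fin m → ℝ) → (Fin n → Fin m → ℝ)) (hp : ContDiff ℝ (⊤ : ℕ∞) p)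
    (Z : (Fin m → ℝ) → (Fin n → ℝ)) (hZ : ContDiff ℝ (⊤ : ℕ∞) Z) (hZc : HasCompactSupport Z)
    (W : (Fin m → ℝ) → (Fin n → Fin m → ℝ)) (hW : ContDiff ℝ (⊤ : ℕ∞) W)
    (hWc : HasCompactSupport W) :
    HasDerivAt
      (fun t : ℝ => ∫ x : Fin m → ℝ,
        ((∑ A : Fin n, ∑ ν : Fin m,
            (p x A ν + t * W x A ν) * pd (fun x' => y x' A + t * Z x' A) ν x)
          - h (x, y x + t • Z x, p x + t • W x)
        - ((∑ A : Fin n, ∑ ν : Fin m, p x A ν * pd (fun x' => y x' A) ν x)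
          - h (x, y x, p x))))
      (∫ x : Fin m → ℝ,
        ((∑ A : Fin n, ∑ ν : Fin m, W x A ν *
            (pd (fun x' => y x' A) ν x - Lv h (x, y x, p x) A ν))
        - ∑ A : Fin n, Z x A *
            ((∑ ν : Fin m, pd (fun x' => p x' A ν) ν x) + Ly h (x, y x, p x) A)))
      0 := by
  have hyA (A) : ContDiff ℝ (⊤ : ℕ∞) fun x => y x A := contDiff_pi.1 hy A
  have hZA (A) : ContDiff ℝ (⊤ : ℕ∞) fun x => Z x A := contDiff_pi.1 hZ A
  have hpA (A ν) : ContDiff ℝ (⊤ : ℕ∞) fun x => p x A ν := contDiff_pi.1 (contDiff_pi.1 hp A) ν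
  have hZAc (A) : HasCompactSupport fun x => Z x A :=
    hZc.comp_left (g := fun u : Fin n → ℝ => u A) rfl
  have hdy (A ν) := continuous_pd (hyA A) ν
  have hdZ (A ν) := continuous_pd (hZA A) ν
  have hdp (A ν ν') := continuous_pd (hpA A ν) ν'
  have hcy := hy.continuous
  have hcZ := hZ.continuous
  have hcp := hp.continuous
  have hcW := hW.continuous
  have hch := hh.continuous
  have hcdh : Continuous (fderiv ℝ h) := hh.continuous_fderiv (by simp)
  let K : Set (Fin m → ℝ) := tsupport Z ∪ tsupport W
  have hK : IsCompact K := hZc.isCompact.union hWc.isCompact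
  have hZ0 {x} (hx : x ∉ K) : Z x = 0 := image_eq_zero_of_notMem_tsupport fun hx' => hx (.inl hx')
  have hW0 {x} (hx : x ∉ K) : W x = 0 := image_eq_zero_of_notMem_tsupport fun hx' => hx (.inr hx')
  have hdZ0 {x} (hx : x ∉ K) (A ν) : pd (fun x' => Z x' A) ν x = 0 :=
    pd_eq_zero_of_notMem_tsupport ν fun hx' => hx <| .inl <|
      tsupport_comp_subset (g := fun u : Fin n → ℝ => u A) rfl Z hx'
  simp only [fun A => pd_add_const_mul ((hyA A).differentiable (by simp))
    ((hZA A).differentiable (by simp))]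
  let F' : ℝ → (Fin m → ℝ) → ℝ := fun t x =>
    (∑ A, ∑ ν, (W x A ν * (pd (fun x' => y x' A) ν x + t * pd (fun x' => Z x' A) ν x)
      + (p x A ν + t * W x A ν) * pd (fun x' => Z x' A) ν x))
    - fderiv ℝ h (x, y x + t • Z x, p x + t • W x) (0, Z x, W x)
  have hF' : Continuous (Function.uncurry F') := by
    simp only [F', Function.uncurry_def]
    fun_prop
  have hF'_off (t : ℝ) (x) (hx : x ∉ K) : F' t x = 0 := by
    have : ((0, 0, 0) : (Fin m → ℝ) × (Fin n → ℝ) × (Fin n → Fin m → ℝ)) = 0 := rfl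
    simp [F', hZ0 hx, hW0 hx, hdZ0 hx, this]
  have hF'_zero (x) : F' 0 x =
      ((∑ A, ∑ ν, W x A ν * (pd (fun x' => y x' A) ν x - Lv h (x, y x, p x) A ν))
        - ∑ A, Z x A * ((∑ ν, pd (fun x' => p x' A ν) ν x) + Ly h (x, y x, p x) A))
      + ∑ A, ∑ ν, (p x A ν * pd (fun x' => Z x' A) ν x
          + pd (fun x' => p x' A ν) ν x * Z x A) := by
    simp only [F', zero_smul, add_zero, zero_mul, fderiv_vertical_eq_sum, mul_sub, mul_add,
      Finset.sum_add_distrib, Finset.sum_sub_distrib, ← Finset.sum_mul]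
    simp only [mul_comm (Z _ _)]
    ring
  have hint₁ (A : Fin n) (ν : Fin m) :
      Integrable fun x => p x A ν * pd (fun x' => Z x' A) ν x :=
    Continuous.integrable_of_hasCompactSupport (by fun_prop)
      (hasCompactSupport_pd (hZAc A) ν).mul_left
  have hint₂ (A : Fin n) (ν : Fin m) :
      Integrable fun x => pd (fun x' => p x' A ν) ν x * Z x A :=
    Continuous.integrable_of_hasCompactSupport (by fun_prop) (hZAc A).mul_left
  have hint (A : Fin n) (ν : Fin m) : Integrable fun x =>
      p x A ν * pd (fun x' => Z x' A) ν x + pd (fun x' => p x' A ν) ν x * Z x A :=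
    (hint₁ A ν).add (hint₂ A ν)
  have hdiv : ∫ x, ∑ A, ∑ ν, (p x A ν * pd (fun x' => Z x' A) ν x
      + pd (fun x' => p x' A ν) ν x * Z x A) = 0 := by
    rw [integral_finsetSum _ fun A _ => integrable_finsetSum _ fun ν _ =>
      hint A ν]
    refine Finset.sum_eq_zero fun A _ => ?_
    rw [integral_finsetSum _ fun ν _ => hint A ν]
    refine Finset.sum_eq_zero fun ν _ => ?_
    rw [integral_add (hint₁ A ν) (hint₂ A ν), integral_mul_pd_eq_neg (hpA A ν) (hZA A) (hZAc A) ν,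
      neg_add_cancel]
  have hF'int : Integrable (F' 0) :=
    (hF'.comp (Continuous.prodMk_right 0)).integrable_of_hasCompactSupport (.intro hK (hF'_off 0))
  have hval : ∫ x, ((∑ A, ∑ ν, W x A ν *
        (pd (fun x' => y x' A) ν x - Lv h (x, y x, p x) A ν))
      - ∑ A, Z x A * ((∑ ν, pd (fun x' => p x' A ν) ν x) + Ly h (x, y x, p x) A))
      = ∫ x, F' 0 x := by
    simp only [fun x => eq_sub_of_add_eq (hF'_zero x).symm]
    rw [integral_sub hF'int (integrable_finsetSum _ fun A _ => integrable_finsetSum _ fun ν _ =>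
      hint A ν), hdiv, sub_zero]
  rw [hval]
  refine hasDerivAt_integral_of_eq_zero_off_compact hK ?_ hF' ?_ hF'_off ?_ 0
  · simp only [Function.uncurry_def]
    fun_prop
  · intro t x hx
    simp [hZ0 hx, hW0 hx, hdZ0 hx]
  · intro t x
    have hlin (a b : ℝ) : HasDerivAt (fun s : ℝ => a + s * b) b t := by
      simpa using ((hasDerivAt_id t).mul_const b).const_add a
    have hcurve : HasDerivAt (fun s : ℝ => (x, y x + s • Z x, p x + s • W x)) (0, Z x, W x) t := by
      have hy' := ((hasDerivAt_id t).smul_const (Z x)).const_add (y x)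
      have hp' := ((hasDerivAt_id t).smul_const (W x)).const_add (p x)
      simpa using (hasDerivAt_const t x).prodMk (hy'.prodMk hp')
    have hh' := ((hh.differentiable (by simp)) (x, y x + t • Z x, p x + t • W x)).hasFDerivAt
      |>.comp_hasDerivAt t hcurve
    refine (HasDerivAt.sub (.fun_sum fun A _ => .fun_sum fun ν _ => ?_) hh').sub_const _
    exact (hlin _ _).mul (hlin _ _)
end

section
/- The primary Legendre constraint in the unified formalism (coordinate version of part of Theorem 4, determining the first constraint submanifold W₁ = graph of the Legendre map): Let L : J → ℝ be smooth. If (y, v, p) is a critical unified section, then p^ν_A(x) = (∂L/∂v^A_ν)(x, y(x), v(x)) for every x, A, ν. -/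
open MeasureTheory

/-- The unified (Lagrange–Hamilton) action density. -/
noncomputable def U {m n : ℕ} (L : (Fin m → ℝ) × (Fin n → ℝ) × (Fin n → Fin m → ℝ) → ℝ)
    (y : (Fin m → ℝ) → (Fin n → ℝ)) (v p : (Fin m → ℝ) → (Fin n → Fin m → ℝ))
    (x : Fin m → ℝ) : ℝ :=
  L (x, y x, v x) +
    ∑ A : Fin n, ∑ ν : Fin m, p x A ν * (pd (fun x' => y x' A) ν x - v x A ν)

/-- `(y, v, p)` is a critical section of the unified action. -/
noncomputable def CriticalUnified {m n : ℕ}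
    (L : (Fin m → ℝ) × (Fin n → ℝ) × (Fin n → Fin m → ℝ) → ℝ)
    (y : (Fin m → ℝ) → (Fin n → ℝ)) (v p : (Fin m → ℝ) → (Fin n → Fin m → ℝ)) : Prop :=
  ∀ (Z : (Fin m → ℝ) → (Fin n → ℝ)) (V W : (Fin m → ℝ) → (Fin n → Fin m → ℝ)),
    ContDiff ℝ (⊤ : ℕ∞) Z → HasCompactSupport Z → ContDiff ℝ (⊤ : ℕ∞) V → HasCompactSupport V →
    ContDiff ℝ (⊤ : ℕ∞) W → HasCompactSupport W →
    HasDerivAt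
      (fun t : ℝ => ∫ x : Fin m → ℝ,
        (U L (y + t • Z) (v + t • V) (p + t • W) x - U L y v p x)) 0 0

/-- Differentiation under the integral sign for a family whose derivative in the parameter is
jointly continuous up to a compactly supported factor. -/
theorem hasDerivAt_integral_of_compactSupport_mul {m : ℕ} {F G : ℝ → (Fin m → ℝ) → ℝ}
    {φ : (Fin m → ℝ) → ℝ} (hφ : Continuous φ) (hφs : HasCompactSupport φ)
    (hF : ∀ t, Continuous (F t)) (hF0 : F 0 = 0) (hG : Continuous (Function.uncurry G))
    (hFG : ∀ t x, HasDerivAt (F · x) (φ x * G t x) t) :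
    HasDerivAt (fun t => ∫ x, F t x) (∫ x, φ x * G 0 x) 0 := by
  obtain ⟨C, hC⟩ := ((isCompact_Icc (a := (-1 : ℝ)) (b := 1)).prod
    hφs.isCompact).exists_bound_of_continuousOn hG.continuousOn
  refine (hasDerivAt_integral_of_dominated_loc_of_deriv_le (F' := fun t x => φ x * G t x)
    (bound := fun x => ‖φ x‖ * C) (Icc_mem_nhds (a := (-1 : ℝ)) (b := 1) (by norm_num)
    (by norm_num)) (.of_forall fun t => (hF t).aestronglyMeasurable) ?_ ?_ ?_ ?_ ?_).2
  · rw [hF0]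
    exact integrable_zero _ _ _
  · exact (hφ.mul (hG.comp (by fun_prop : Continuous fun x => ((0 : ℝ), x)))).aestronglyMeasurable
  · refine .of_forall fun x t ht => ?_
    rw [norm_mul]
    by_cases hx : x ∈ tsupport φ
    · exact mul_le_mul_of_nonneg_left (hC (t, x) ⟨ht, hx⟩) (norm_nonneg _)
    · simp [image_eq_zero_of_notMem_tsupport hx]
  · exact (hφ.integrable_of_hasCompactSupport hφs).norm.mul_const C
  · exact .of_forall fun x t _ => hFG t x

/-- A variation of the velocity in one coordinate direction changes the unified density by the
change of the Lagrangian minus the pairing with the momentum. -/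
theorem U_add_smul_single_sub {m n : ℕ}
    (L : (Fin m → ℝ) × (Fin n → ℝ) × (Fin n → Fin m → ℝ) → ℝ)
    (y : (Fin m → ℝ) → (Fin n → ℝ)) (v p : (Fin m → ℝ) → (Fin n → Fin m → ℝ))
    (φ : (Fin m → ℝ) → ℝ) (A : Fin n) (ν : Fin m) (t : ℝ) (x : Fin m → ℝ) :
    U L y (v + t • fun x => φ x • (Pi.single A (Pi.single ν 1) : Fin n → Fin m → ℝ)) p x
        - U L y v p x =
      L (x, y x, v x + t • φ x • (Pi.single A (Pi.single ν 1) : Fin n → Fin m → ℝ))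
        - L (x, y x, v x) - t * (φ x * p x A ν) := by
  have hsum : ∑ B : Fin n, ∑ μ : Fin m,
      p x B μ * (Pi.single A (Pi.single ν 1) : Fin n → Fin m → ℝ) B μ = p x A ν := by
    rw [Finset.sum_eq_single A (fun B _ hB => by simp [Pi.single_eq_of_ne hB]) (by simp)]
    simp [Pi.single_apply]
  have hlin : ∀ B μ, p x B μ * (pd (fun x' => y x' B) μ x -
      (v x B μ + t * (φ x * (Pi.single A (Pi.single ν 1) : Fin n → Fin m → ℝ) B μ))) =
      p x B μ * (pd (fun x' => y x' B) μ x - v x B μ) -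
        t * φ x * (p x B μ * (Pi.single A (Pi.single ν 1) : Fin n → Fin m → ℝ) B μ) :=
    fun B μ => by ring
  simp only [U, Pi.add_apply, Pi.smul_apply, smul_eq_mul, hlin, Finset.sum_sub_distrib,
    ← Finset.mul_sum, hsum]
  ring

/-- The primary Legendre constraint in the unified formalism. -/
theorem legendre_constraint_of_critical_unified_section
    (m n : ℕ) (hm : 0 < m) (hn : 0 < n)
    (L : (Fin m → ℝ) × (Fin n → ℝ) × (Fin n → Fin m → ℝ) → ℝ) (hL : ContDiff ℝ (⊤ : ℕ∞) L)
    (y : (Fin m → ℝ) → (Fin n → ℝ)) (hy : ContDiff ℝ (⊤ : ℕ∞) y)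
    (v : (Fin m → ℝ) → (Fin n → Fin m → ℝ)) (hv : ContDiff ℝ (⊤ : ℕ∞) v)
    (p : (Fin m → ℝ) → (Fin n → Fin m → ℝ)) (hp : ContDiff ℝ (⊤ : ℕ∞) p)
    (hcrit : CriticalUnified L y v p) :
    ∀ (x : Fin m → ℝ) (A : Fin n) (ν : Fin m),
      p x A ν = Lv L (x, y x, v x) A ν := by
  intro x A ν
  have hyc := hy.continuous
  have hvc := hv.continuous
  have hpc := hp.continuous
  have hLc := hL.continuous
  have hL'c : Continuous (fderiv ℝ L) := hL.continuous_fderiv (by simp)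
  have hpA : Continuous fun x => p x A ν := by fun_prop
  let E : Fin n → Fin m → ℝ := Pi.single A (Pi.single ν 1)
  let g : (Fin m → ℝ) → ℝ := fun x => Lv L (x, y x, v x) A ν - p x A ν
  have hg : Continuous g := by
    unfold g Lv
    fun_prop
  have hzero : ∀ φ : (Fin m → ℝ) → ℝ, ContDiff ℝ (⊤ : ℕ∞) φ → HasCompactSupport φ →
      ∫ x, φ x • g x = 0 := by
    intro φ hφ hφs
    have hφc := hφ.continuous
    have hvar := hcrit 0 (fun x => φ x • E) 0 contDiff_const HasCompactSupport.zero
      (hφ.smul contDiff_const) hφs.smul_right contDiff_const HasCompactSupport.zero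
    simp only [smul_zero, add_zero, E, U_add_smul_single_sub] at hvar
    refine HasDerivAt.unique ?_ hvar
    have hder := hasDerivAt_integral_of_compactSupport_mul
      (F := fun t x => L (x, y x, v x + t • φ x • E) - L (x, y x, v x) - t * (φ x * p x A ν))
      (G := fun t x => Lv L (x, y x, v x + t • φ x • E) A ν - p x A ν) hφc hφs
      (fun t => by fun_prop) (by ext x; simp)
      (by unfold Lv Function.uncurry; fun_prop) ?_
    · simpa [g] using hder
    · intro t x
      have hcurve : HasDerivAt (fun t : ℝ => (x, y x, v x + t • φ x • E))
          (φ x • ((0, 0, E) : (Fin m → ℝ) × (Fin n → ℝ) × (Fin n → Fin m → ℝ))) t := by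
        have h := ((hasDerivAt_id t).smul_const (φ x • E)).const_add (v x)
        simpa using (hasDerivAt_const t x).prodMk ((hasDerivAt_const t (y x)).prodMk h)
      have hLt := ((hL.differentiable (by simp)) _).hasFDerivAt.comp_hasDerivAt t hcurve
      refine ((hLt.sub_const (L (x, y x, v x))).sub
        ((hasDerivAt_id t).mul_const (φ x * p x A ν))).congr_deriv ?_
      simp only [map_smul, smul_eq_mul, Lv, E]
      ring
  have hae : g =ᵐ[volume] 0 :=
    ae_eq_zero_of_integral_contDiff_smul_eq_zero hg.locallyIntegrable hzero
  have hgx : g x = 0 := congrFun ((hg.ae_eq_iff_eq volume continuous_zero).1 hae) x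
  exact (sub_eq_zero.1 hgx).symm
end
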